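/- Let π ∈ 𝒜 be a simple permutation of length n ≥ 4 with π(2) ≠ 1, let p = π⁻¹(1) be the position of its minimum, and let m be the position in {1,…,p−1} at which π attains its maximum over positions 1,…,p−1. Then π is strictly increasing on positions 1,…,m. -/

import Mathlib

/-- `σ` is contained in `π` as a pattern. -/
def Contains {k n : ℕ} (σ : Equiv.Perm (Fin k)) (π : Equiv.Perm (Fin n)) : Prop :=
  ∃ f : Fin k → Fin n, StrictMono f ∧ ∀ i j : Fin k, σ i < σ j ↔ π (f i) < π (f j)

/-- `π` avoids the pattern `σ`. -/
def Avoids {k n : ℕ} (σ : Equiv.Perm (Fin k)) (π : Equiv.Perm (Fin n)) : Prop :=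
  ¬ Contains σ π

/-- The permutation 4231 (0-indexed values). -/
noncomputable def p4231 : Equiv.Perm (Fin 4) := Equiv.ofBijective ![3,1,2,0] (by decide)

/-- The permutation 35142 (0-indexed values). -/
noncomputable def p35142 : Equiv.Perm (Fin 5) := Equiv.ofBijective ![2,4,0,3,1] (by decide)

/-- The permutation 42513 (0-indexed values). -/
noncomputable def p42513 : Equiv.Perm (Fin 5) := Equiv.ofBijective ![3,1,4,0,2] (by decide)

/-- The permutation 351624 (0-indexed values). -/
noncomputable def p351624 : Equiv.Perm (Fin 6) := Equiv.ofBijective ![2,4,0,5,1,3] (by decide)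

/-- Membership in the class 𝒜 = Av(4231, 35142, 42513, 351624). -/
def InA {n : ℕ} (π : Equiv.Perm (Fin n)) : Prop :=
  Avoids p4231 π ∧ Avoids p35142 π ∧ Avoids p42513 π ∧ Avoids p351624 π

/-- `s` is an interval of `π`: a set of consecutive positions whose image
under `π` is a set of consecutive values. -/
def IsPermInterval {n : ℕ} (π : Equiv.Perm (Fin n)) (s : Finset (Fin n)) : Prop :=
  (∀ a ∈ s, ∀ b ∈ s, ∀ j : Fin n, a ≤ j → j ≤ b → j ∈ s) ∧
  (∀ a ∈ s, ∀ b ∈ s, ∀ j : Fin n, π a ≤ π j → π j ≤ π b → j ∈ s)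

/-- `π` is simple: its only intervals are singletons (or empty) and the whole domain. -/
def IsSimple {n : ℕ} (π : Equiv.Perm (Fin n)) : Prop :=
  ∀ s : Finset (Fin n), IsPermInterval π s → s.card ≤ 1 ∨ s = Finset.univ

/-- The reverse complement of a permutation. -/
def revComp {n : ℕ} (π : Equiv.Perm (Fin n)) : Equiv.Perm (Fin n) :=
  (Fin.revPerm.trans π).trans Fin.revPerm

/-- The skew sum `σ ⊖ τ`. -/
def skewSum {m k : ℕ} (σ : Equiv.Perm (Fin m)) (τ : Equiv.Perm (Fin k)) :
    Equiv.Perm (Fin (m + k)) :=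
  finSumFinEquiv.symm.trans ((Equiv.sumCongr σ τ).trans
    ((Equiv.sumComm (Fin m) (Fin k)).trans (finSumFinEquiv.trans (finCongr (Nat.add_comm k m)))))

/-- The direct sum `α ⊕ β`. -/
def directSum {m k : ℕ} (α : Equiv.Perm (Fin m)) (β : Equiv.Perm (Fin k)) :
    Equiv.Perm (Fin (m + k)) :=
  finSumFinEquiv.symm.trans ((Equiv.sumCongr α β).trans finSumFinEquiv)

/-- The permutation 312 (0-indexed values). -/
noncomputable def p312 : Equiv.Perm (Fin 3) := Equiv.ofBijective ![2,0,1] (by decide)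

/-- The permutation 231 (0-indexed values). -/
noncomputable def p231 : Equiv.Perm (Fin 3) := Equiv.ofBijective ![1,2,0] (by decide)

/-- The number of simple permutations of length `n` in the class 𝒜. -/
noncomputable def simpleCount (n : ℕ) : ℕ :=
  Nat.card {π : Equiv.Perm (Fin n) // IsSimple π ∧ InA π}

/-- Four positions whose values are ordered like 4231 give an occurrence of 4231. -/
lemma contains_p4231 {n : ℕ} {π : Equiv.Perm (Fin n)} {a b c d : Fin n}
    (hab : a < b) (hbc : b < c) (hcd : c < d)
    (hdb : π d < π b) (hbc' : π b < π c) (hca : π c < π a) : Contains p4231 π := by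
  refine ⟨![a, b, c, d], Fin.strictMono_iff_lt_succ.2 fun i => ?_, fun i j => ?_⟩
  · fin_cases i <;> simp <;> assumption
  · fin_cases i <;> fin_cases j <;> simp [p4231] <;> order

/-- Five positions whose values are ordered like 42513 give an occurrence of 42513. -/
lemma contains_p42513 {n : ℕ} {π : Equiv.Perm (Fin n)} {a b c d e : Fin n}
    (hab : a < b) (hbc : b < c) (hcd : c < d) (hde : d < e)
    (hdb : π d < π b) (hbe : π b < π e) (hea : π e < π a) (hac : π a < π c) :
    Contains p42513 π := by
  refine ⟨![a, b, c, d, e], Fin.strictMono_iff_lt_succ.2 fun i => ?_, fun i j => ?_⟩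
  · fin_cases i <;> simp <;> assumption
  · fin_cases i <;> fin_cases j <;> simp [p42513] <;> order

/-- `c` splits the positions before `m` into a lower-left part and an upper-right part. -/
def IsCut {n : ℕ} (π : Equiv.Perm (Fin n)) (m c : Fin n) : Prop :=
  ∀ x y : Fin n, x < c → c ≤ y → y < m → π x < π y

/-- If no inversion before `m` straddles the value `v`, but values on both sides of `v` occur
before `m`, then there is a cut between them. -/
lemma exists_isCut_of_no_inversion {n : ℕ} (π : Equiv.Perm (Fin n)) {m a b v : Fin n}
    (ham : a < m) (hav : π a < v) (hvb : v < π b) (hv : ∀ y, y < m → π y ≠ v)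
    (hno : ∀ u w, u < w → w < m → π w < v → ¬ v < π u) :
    ∃ k, a < k ∧ k ≤ b ∧ IsCut π m k := by
  obtain ⟨k, hk, hmin⟩ := Finset.exists_min_image
    (Finset.univ.filter fun y => v < π y) id ⟨b, by simpa using hvb⟩
  simp only [Finset.mem_filter, Finset.mem_univ, true_and, id] at hk hmin
  refine ⟨k, ?_, hmin b hvb, fun x y hx hy hym => ?_⟩
  · by_contra! h
    rcases h.eq_or_lt with rfl | h
    · order
    · exact hno k a h ham hav hk
  · have hxv : π x ≤ v := by
      by_contra! h
      exact absurd (hmin x h) (not_le.2 hx)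
    have hvy : v < π y := by
      rcases hy.eq_or_lt with rfl | h
      · exact hk
      · by_contra! h'
        exact hno k y h hym (lt_of_le_of_ne h' (hv y hym)) hk
    order

theorem statement_11 {n : ℕ} (hn : 4 ≤ n) (π : Equiv.Perm (Fin n))
    (hsimple : IsSimple π) (hA : InA π) (h2 : π ⟨1, by omega⟩ ≠ ⟨0, by omega⟩)
    (p m : Fin n) (hp : p = π⁻¹ ⟨0, by omega⟩) (hmp : m < p)
    (hmax : ∀ i : Fin n, i < p → π i ≤ π m) :
    ∀ i j : Fin n, i < j → j ≤ m → π i < π j := by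
  intro i j hij hjm
  by_contra! hji
  have hlt : π j < π i := lt_of_le_of_ne hji (fun h => hij.ne' (π.injective h))
  have hjm' : j < m := lt_of_le_of_ne hjm (by
    rintro rfl
    exact absurd (hmax i (hij.trans hmp)) (not_le.2 hlt))
  have hpos : ∀ x, x ≠ p → π p < π x := fun x hx => by
    have hp0 : π p = ⟨0, by omega⟩ := by simp [hp]
    refine lt_of_le_of_ne ?_ (fun h => hx (π.injective h).symm)
    rw [hp0]
    exact Nat.zero_le _
  -- no inversion before `m` is separated by value by a later entry
  have hsep : ∀ u w x, u < w → w < m → m ≤ x → π w < π x → ¬ π x < π u := by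
    intro u w x huw hwm hmx hwx hxu
    have hum := hmax u (by order)
    have hpw := hpos w (by order)
    have hum' : π u ≠ π m := fun h => (huw.trans hwm).ne (π.injective h)
    rcases lt_trichotomy x p with hxp | rfl | hpx
    · have : m ≠ x := by rintro rfl; order
      exact hA.1 (contains_p4231 huw (by order) hxp hpw hwx hxu)
    · order
    · exact hA.2.2.1 (contains_p42513 huw hwm hmp hpx hpw hwx hxu (by order))
  obtain ⟨lo, hlo, hlomax⟩ := Set.exists_max_image {c | c ≤ i ∧ IsCut π m c} id (Set.toFinite _)
    ⟨⟨0, by omega⟩, Nat.zero_le _, fun x y hx => absurd hx (Nat.not_lt_zero _)⟩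
  obtain ⟨hi, hhi, hhimin⟩ := Set.exists_min_image {c | i < c ∧ IsCut π m c} id (Set.toFinite _)
    ⟨m, hij.trans hjm', fun x y _ h h' => absurd h (not_le.2 h')⟩
  simp only [Set.mem_ofPred_eq, id, and_imp] at hlo hhi hlomax hhimin
  have hhim : hi ≤ m := hhimin m (hij.trans hjm') fun x y _ h h' => absurd h (not_le.2 h')
  have hjhi : j < hi := by
    by_contra! h
    exact absurd (hhi.2 i j hhi.1 h hjm') hji.not_gt
  have hint : IsPermInterval π (Finset.Ico lo hi) := by
    refine ⟨fun a ha b hb x hax hxb => ?_, fun a ha b hb x hax hxb => ?_⟩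
    · rw [Finset.mem_Ico] at *
      exact ⟨by order, by order⟩
    · rw [Finset.mem_Ico] at ha hb
      by_contra hx
      have hne : ∀ y, lo ≤ y ∧ y < hi → π y ≠ π x := by
        rintro y hy h
        rw [π.injective h] at hy
        exact hx (Finset.mem_Ico.2 hy)
      have hax' := lt_of_le_of_ne hax (hne a ha)
      have hxb' := lt_of_le_of_ne hxb (hne b hb).symm
      rcases lt_or_ge x lo with hxlo | hlox
      · have := hlo.2 x a hxlo ha.1 (by order)
        order
      have hhix : hi ≤ x := by
        by_contra! h
        exact hx (Finset.mem_Ico.2 ⟨hlox, h⟩)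
      rcases lt_or_ge x m with hxm | hmx
      · have := hhi.2 b x hb.2 hhix hxm
        order
      obtain ⟨k, hak, hkb, hk⟩ := exists_isCut_of_no_inversion π (m := m) (by order) hax' hxb'
        (fun y hy h => absurd (π.injective h) (by order))
        (fun u w huw hwm => hsep u w x huw hwm hmx)
      rcases le_or_gt k i with hki | hik
      · have := hlomax k hki hk
        order
      · have := hhimin k hik hk
        order
  rcases hsimple _ hint with hcard | huniv
  · exact hij.ne (Finset.card_le_one.1 hcard i (Finset.mem_Ico.2 ⟨hlo.1, hhi.1⟩) j
      (Finset.mem_Ico.2 ⟨by order, hjhi⟩))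
  · have := Finset.mem_Ico.1 (huniv ▸ Finset.mem_univ m)
    order
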